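/- Let 0 < r ≤ 1/3, n ≥ 1, and φ ∈ [0, 2π). If R_r^n(φ) ≡ φ (mod 2π), then n is even and φ ∈ {0, π, φ_c, 2π − φ_c}; i.e. the only periodic points of R_r modulo 2π are the two 2-cycles {0, π} and {φ_c, −φ_c}, and R_r has no periodic orbit of odd period. -/

import Mathlib

open Real Filter

/-- The reflection map of the unit circle with light source at `(r,0)`. -/
noncomputable def R (r : ℝ) (φ : ℝ) : ℝ :=
  φ + π - 2 * arctan (r * sin φ / (1 - r * cos φ))

/-- The angle `φ_c ∈ (0,π)` with `cos φ_c = (1 − √(1+8r²))/(4r)`. -/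
noncomputable def φc (r : ℝ) : ℝ :=
  arccos ((1 - Real.sqrt (1 + 8 * r ^ 2)) / (4 * r))

/-- `x`-coordinate of the caustic of `R_r^n`. -/
noncomputable def xc (r : ℝ) (n : ℕ) (φ : ℝ) : ℝ :=
  (deriv ((R r)^[n]) φ * cos φ + cos ((R r)^[n] φ)) / (1 + deriv ((R r)^[n]) φ)

/-- `y`-coordinate of the caustic of `R_r^n`. -/
noncomputable def yc (r : ℝ) (n : ℕ) (φ : ℝ) : ℝ :=
  (deriv ((R r)^[n]) φ * sin φ + sin ((R r)^[n] φ)) / (1 + deriv ((R r)^[n]) φ)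

/-- The quantity `A_n(φ) = −(R_r^n)'(φ) + ((R_r^n)'(φ))³ + 2 (R_r^n)'''(φ)`. -/
noncomputable def A (r : ℝ) (n : ℕ) (φ : ℝ) : ℝ :=
  -(deriv ((R r)^[n]) φ) + (deriv ((R r)^[n]) φ) ^ 3 + 2 * iteratedDeriv 3 ((R r)^[n]) φ

lemma one_sub_mul_cos_pos {r : ℝ} (hr : 0 < r) (hr1 : r ≤ 1 / 3) (φ : ℝ) :
    0 < 1 - r * cos φ := by
  nlinarith [cos_le_one φ]

lemma hasDerivAt_R {r : ℝ} (hr : 0 < r) (hr1 : r ≤ 1 / 3) (φ : ℝ) :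
    HasDerivAt (R r)
      ((1 - 4 * r * cos φ + 3 * r ^ 2) / ((1 - r * cos φ) ^ 2 + (r * sin φ) ^ 2)) φ := by
  have hq := one_sub_mul_cos_pos hr hr1 φ
  have h := (((hasDerivAt_id φ).add_const π).sub
    (((((hasDerivAt_sin φ).const_mul r).div
      (((hasDerivAt_cos φ).const_mul r).const_sub 1) hq.ne').arctan).const_mul 2))
  have hd : (1 - r * cos φ) ^ 2 + (r * sin φ) ^ 2 ≠ 0 := by positivity
  refine h.congr_deriv ?_
  simp only [Pi.div_apply]
  field_simp
  linear_combination (3 * r ^ 2) * sin_sq_add_cos_sq φ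

lemma monotone_R {r : ℝ} (hr : 0 < r) (hr1 : r ≤ 1 / 3) : Monotone (R r) := by
  refine monotone_of_hasDerivAt_nonneg (fun φ => hasDerivAt_R hr hr1 φ) fun φ => ?_
  have : 0 ≤ 1 - 4 * r * cos φ + 3 * r ^ 2 := by nlinarith [cos_le_one φ]
  show (0 : ℝ) ≤ _
  positivity

lemma R_add_two_pi_mul (r φ : ℝ) (k : ℤ) : R r (φ + 2 * π * k) = R r φ + 2 * π * k := by
  have h : φ + 2 * π * k = φ + k * (2 * π) := by ring
  simp only [R, h, sin_add_int_mul_two_pi, cos_add_int_mul_two_pi]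
  ring

lemma iterate_R_add_two_pi_mul (r φ : ℝ) (k : ℤ) (n : ℕ) :
    (R r)^[n] (φ + 2 * π * k) = (R r)^[n] φ + 2 * π * k :=
  Function.Commute.iterate_left (f := R r) (g := fun x => x + 2 * π * k)
    (fun x => R_add_two_pi_mul r x k) n φ

/-- The second iterate of the reflection map, lifted so that it fixes `0`. -/
noncomputable def secondReturn (r φ : ℝ) : ℝ := R r (R r φ) - 2 * π

lemma monotone_secondReturn {r : ℝ} (hr : 0 < r) (hr1 : r ≤ 1 / 3) :
    Monotone (secondReturn r) := fun _ _ h =>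
  sub_le_sub_right (monotone_R hr hr1 (monotone_R hr hr1 h)) _

lemma secondReturn_zero (r : ℝ) : secondReturn r 0 = 0 := by
  simp [secondReturn, R]; ring

lemma secondReturn_two_pi (r : ℝ) : secondReturn r (2 * π) = 2 * π := by
  have h := R_add_two_pi_mul r 0 1
  have h' := R_add_two_pi_mul r (R r 0) 1
  have h0 := secondReturn_zero r
  simp only [Int.cast_one, mul_one, zero_add, secondReturn] at *
  rw [h, h']
  linarith

lemma iterate_secondReturn (r φ : ℝ) (n : ℕ) :
    (secondReturn r)^[n] φ = (R r)^[n] ((R r)^[n] φ) - 2 * π * n := by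
  induction n with
  | zero => simp
  | succ n ih =>
    have h := R_add_two_pi_mul r ((R r)^[n] ((R r)^[n] φ)) (-n)
    have h' := R_add_two_pi_mul r (R r ((R r)^[n] ((R r)^[n] φ))) (-n)
    push_cast at h h'
    rw [Function.iterate_succ_apply', ih, secondReturn,
      sub_eq_add_neg _ (2 * π * (n : ℝ)), ← mul_neg, h, h',
      Function.iterate_succ_apply', Function.iterate_succ_apply' (R r) n φ,
      ← Function.iterate_succ_apply (R r) n, Function.iterate_succ_apply' (R r) n]
    push_cast
    ring

lemma Monotone.map_eq_of_iterate_eq {α : Type*} [LinearOrder α] {f : α → α} (hf : Monotone f)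
    {x : α} {n : ℕ} (hn : 1 ≤ n) (h : f^[n] x = x) : f x = x := by
  rcases le_total x (f x) with hx | hx
  · exact le_antisymm (by simpa [h] using hf.monotone_iterate_of_le_map hx hn) hx
  · exact le_antisymm hx (by simpa [h] using hf.antitone_iterate_of_map_le hx hn)

/-- Fixed points of the second return satisfy either `sin φ = 0` or the quadratic equation
for the second `2`-cycle. -/
lemma sin_eq_zero_or_of_secondReturn_eq {r : ℝ} (hr : 0 < r) (hr1 : r ≤ 1 / 3) {φ : ℝ}
    (h : secondReturn r φ = φ) :
    sin φ = 0 ∨ cos φ + r - 2 * r * cos φ ^ 2 = 0 := by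
  have hq := one_sub_mul_cos_pos hr hr1 φ
  have hq' := one_sub_mul_cos_pos hr hr1 (R r φ)
  set a := arctan (r * sin φ / (1 - r * cos φ)) with ha
  have hψ : R r φ = φ + π - 2 * a := rfl
  have hca : 0 < cos a := cos_arctan_pos _
  have hsa : sin a * (1 - r * cos φ) = r * sin φ * cos a := by
    have h1 := tan_arctan (r * sin φ / (1 - r * cos φ))
    rw [← ha, tan_eq_sin_div_cos, div_eq_div_iff hca.ne' hq.ne'] at h1
    exact h1
  have hsum : arctan (r * sin (R r φ) / (1 - r * cos (R r φ))) = -a := by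
    have h2 : R r φ + π - 2 * arctan (r * sin (R r φ) / (1 - r * cos (R r φ))) - 2 * π = φ := h
    linarith
  rw [ha, ← arctan_neg, arctan_inj, ← neg_div, div_eq_div_iff hq'.ne' hq.ne'] at hsum
  have hsψ : sin (R r φ) = -sin ((φ - a) - a) := by
    rw [hψ, ← sin_add_pi]; congr 1; ring
  have hcψ : cos (R r φ) = -cos ((φ - a) - a) := by
    rw [hψ, ← cos_add_pi]; congr 1; ring
  have hsφ : sin φ = sin ((φ - a) + a) := by congr 1; ring
  have hcφ : cos φ = cos ((φ - a) + a) := by congr 1; ring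
  have key : cos (φ - a) * (sin a + r * sin (φ - a)) = 0 := by
    rw [hsψ, hcψ, hsφ, hcφ] at hsum
    simp only [sin_add, sin_sub (φ - a), cos_add, cos_sub (φ - a)] at hsum
    have e := sin_sq_add_cos_sq a
    have : r * (cos (φ - a) * (sin a + r * sin (φ - a))) = 0 := by
      linear_combination hsum / 2 - r ^ 2 * sin (φ - a) * cos (φ - a) * e
    exact (mul_eq_zero.mp this).resolve_left hr.ne'
  have hs := sin_sq_add_cos_sq φ
  rcases mul_eq_zero.mp key with hk | hk
  · right
    rw [cos_sub] at hk
    have : cos a * (cos φ + r - 2 * r * cos φ ^ 2) = 0 := by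
      linear_combination (1 - r * cos φ) * hk - sin φ * hsa - r * cos a * hs
    exact (mul_eq_zero.mp this).resolve_left hca.ne'
  · left
    rw [sin_sub] at hk
    have : (2 * r * cos a * (1 - r * cos φ)) * sin φ = 0 := by
      linear_combination (1 - r * cos φ) * hk - (1 - r * cos φ) * hsa
    exact (mul_eq_zero.mp this).resolve_left (by positivity)

lemma cos_eq_of_quadratic {r c : ℝ} (hr : 0 < r) (hr1 : r ≤ 1 / 3) (hc : c ≤ 1)
    (h : c + r - 2 * r * c ^ 2 = 0) : c = (1 - √(1 + 8 * r ^ 2)) / (4 * r) := by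
  have h1 : 1 + 8 * r ^ 2 = (1 - 4 * r * c) ^ 2 := by linear_combination 8 * r * h
  have h2 : 0 ≤ 1 - 4 * r * c := by
    by_contra! hneg
    have hc0 : 0 < c := by
      by_contra! hc0
      nlinarith
    have : 0 < c * (1 - 2 * r * c) := mul_pos hc0 (by nlinarith)
    linarith
  rw [h1, sqrt_sq h2]
  field_simp
  ring

lemma eq_arccos_or_of_cos_eq {φ c : ℝ} (hφ : φ ∈ Set.Ico 0 (2 * π)) (h : cos φ = c) :
    φ = arccos c ∨ φ = 2 * π - arccos c := by
  subst h
  rcases le_total φ π with hπ | hπ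
  · exact .inl (arccos_cos hφ.1 hπ).symm
  · right
    rw [← cos_two_pi_sub, arccos_cos (by linarith [hφ.2]) (by linarith)]
    ring

lemma eq_zero_or_pi_of_sin_eq_zero {φ : ℝ} (hφ : φ ∈ Set.Ico 0 (2 * π)) (h : sin φ = 0) :
    φ = 0 ∨ φ = π := by
  rcases sin_eq_zero_iff_cos_eq.mp h with h1 | h1
  · left
    simpa using (cos_eq_one_iff_of_lt_of_lt (by linarith [hφ.1, pi_pos]) hφ.2).mp h1
  · right
    rcases eq_arccos_or_of_cos_eq hφ h1 with h2 | h2 <;> rw [arccos_neg_one] at h2 <;> linarith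

theorem stmt_16 (r : ℝ) (hr : 0 < r) (hr1 : r ≤ 1 / 3) (n : ℕ) (hn : 1 ≤ n)
    (φ : ℝ) (hφ : φ ∈ Set.Ico 0 (2 * π))
    (hper : ∃ k : ℤ, (R r)^[n] φ = φ + 2 * π * k) :
    Even n ∧ (φ = 0 ∨ φ = π ∨ φ = φc r ∨ φ = 2 * π - φc r) := by
  obtain ⟨k, hk⟩ := hper
  have hmono := monotone_secondReturn hr hr1
  have hiter : (secondReturn r)^[n] φ = φ + 2 * π * (2 * k - n) := by
    rw [iterate_secondReturn, hk, iterate_R_add_two_pi_mul, hk]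
    ring
  have hfix0 : (secondReturn r)^[n] 0 = 0 := Function.iterate_fixed (secondReturn_zero r) n
  have hfix : (secondReturn r)^[n] (2 * π) = 2 * π :=
    Function.iterate_fixed (secondReturn_two_pi r) n
  have hlo := hmono.iterate n hφ.1
  have hhi := hmono.iterate n hφ.2.le
  rw [hiter] at hlo hhi
  rw [hfix0] at hlo
  rw [hfix] at hhi
  have hnk : (2 * k - n : ℤ) = 0 := by
    have hlt : (-1 : ℤ) < 2 * k - n := by
      have : (-1 : ℝ) < 2 * k - n := by nlinarith [hφ.2, pi_pos]
      exact_mod_cast this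
    rcases hφ.1.eq_or_lt with h0 | h0
    · rw [← h0, hfix0, zero_add] at hiter
      have : (2 * k - n : ℝ) = 0 :=
        (mul_eq_zero.mp hiter.symm).resolve_left (by positivity)
      exact_mod_cast this
    · have hgt : 2 * k - n < (1 : ℤ) := by
        have : (2 * k - n : ℝ) < 1 := by nlinarith [pi_pos]
        exact_mod_cast this
      lia
  refine ⟨⟨k.toNat, by lia⟩, ?_⟩
  have hcast : (2 * k - n : ℝ) = 0 := by exact_mod_cast hnk
  rw [hcast, mul_zero, add_zero] at hiter
  rcases sin_eq_zero_or_of_secondReturn_eq hr hr1 (hmono.map_eq_of_iterate_eq hn hiter) with h | h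
  · rcases eq_zero_or_pi_of_sin_eq_zero hφ h with h | h <;> simp [h]
  · exact .inr (.inr (eq_arccos_or_of_cos_eq hφ (cos_eq_of_quadratic hr hr1 (cos_le_one φ) h)))
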